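/- Let α ≥ 0 be real and l ≥ 1 an integer, and define τ(x) := det[ I_{j+k+α}(2√x) ]_{j,k=0,…,l−1} for x > 0. Then there exist polynomials p_0, p_1, …, p_{l+1} with real coefficients, not all identically zero, with deg p_n ≤ ⌊(l+1−n)/2⌋ for each n, such that Σ_{n=0}^{l+1} x^n p_n(x) τ^{(n)}(x) = 0 for all x > 0. In particular (case α = 1), the Hankel determinant τ_l(x) := det[ I_{j+k+1}(2√x) ]_{j,k=0,…,l−1} satisfies a nontrivial linear differential equation of order at most l+1 of this form. -/

import Mathlib

open Real Polynomial

/-- Modified Bessel function of the first kind,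
`I_ν(x) := Σ_{k=0}^∞ (x/2)^{ν+2k}/(k! Γ(ν+k+1))`. -/
noncomputable def besselI (ν : ℝ) (x : ℝ) : ℝ :=
  ∑' k : ℕ, (x / 2) ^ (ν + 2 * (k : ℝ)) / ((k.factorial : ℝ) * Real.Gamma (ν + (k : ℝ) + 1))

/-- `τ(x) := det[I_{j+k+α}(2√x)]_{j,k=0,…,l−1}`. -/
noncomputable def tauHankelShift (α : ℝ) (l : ℕ) (x : ℝ) : ℝ :=
  Matrix.det (fun j k : Fin l =>
    besselI (((j : ℕ) : ℝ) + ((k : ℕ) : ℝ) + α) (2 * Real.sqrt x))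


namespace HankelAux

/-- elementary symmetric polynomial on a finset -/
noncomputable def es {l : ℕ} (s : Finset (Fin l)) (p : ℕ) : MvPolynomial (Fin l) ℝ :=
  (∏ i ∈ s, (1 + Polynomial.X * Polynomial.C (MvPolynomial.X i : MvPolynomial (Fin l) ℝ))).coeff p

variable {l : ℕ}

lemma es_insert_zero (s : Finset (Fin l)) : es s 0 = 1 := by
  unfold es
  rw [Polynomial.coeff_zero_eq_eval_zero, Polynomial.eval_prod]
  simp

lemma es_insert_succ (s : Finset (Fin l)) (i : Fin l) (hi : i ∈ s) (p : ℕ) :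
    es s (p+1) = es (s.erase i) (p+1) + MvPolynomial.X i * es (s.erase i) p := by
  unfold es
  rw [← Finset.mul_prod_erase s _ hi, add_mul, one_mul, Polynomial.coeff_add, mul_assoc,
    Polynomial.coeff_X_mul, Polynomial.coeff_C_mul]

lemma es_deriv (s : Finset (Fin l)) (p : ℕ) :
    ∑ i ∈ s, MvPolynomial.X i * es (s.erase i) p = ((p : MvPolynomial (Fin l) ℝ) + 1) * es s (p+1) := by
  have h := Polynomial.coeff_derivative (∏ i ∈ s, (1 + Polynomial.X * Polynomial.C (MvPolynomial.X i : MvPolynomial (Fin l) ℝ))) p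
  rw [Polynomial.derivative_prod_finset, Polynomial.finsetSum_coeff] at h
  unfold es
  rw [mul_comm, ← h]
  refine Finset.sum_congr rfl fun i _ => ?_
  have : derivative (1 + Polynomial.X * Polynomial.C (MvPolynomial.X i : MvPolynomial (Fin l) ℝ)) = Polynomial.C (MvPolynomial.X i) := by simp
  rw [this, Polynomial.coeff_mul_C, mul_comm]

lemma es_sum (s : Finset (Fin l)) (p : ℕ) :
    ∑ i ∈ s, es (s.erase i) p = ((s.card : MvPolynomial (Fin l) ℝ) - p) * es s p := by
  cases p with
  | zero => simp [es_insert_zero]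
  | succ p =>
    have h := es_deriv s p
    have h2 : ∑ i ∈ s, es s (p+1) = ∑ i ∈ s, es (s.erase i) (p+1) + ∑ i ∈ s, MvPolynomial.X i * es (s.erase i) p := by
      rw [← Finset.sum_add_distrib]
      exact Finset.sum_congr rfl fun i hi => es_insert_succ s i hi p
    rw [h, Finset.sum_const, nsmul_eq_mul] at h2
    push_cast
    linear_combination -h2

lemma es_exists (s : Finset (Fin l)) (p : ℕ) :
    ∃ c, ∀ t : Finset (Fin l), ∀ i ∈ t, t.erase i = s → es t p = es s p + MvPolynomial.X i * c := by
  cases p with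
  | zero => exact ⟨0, by simp [es_insert_zero]⟩
  | succ p => exact ⟨es s p, fun t i hi h => by rw [es_insert_succ t i hi, h]⟩

lemma es_pderiv (s : Finset (Fin l)) (i : Fin l) (hi : i ∉ s) (p : ℕ) :
    MvPolynomial.pderiv i (es s p) = 0 := by
  induction s using Finset.induction_on generalizing p with
  | empty => 
    cases p <;> simp [es, Polynomial.coeff_one]
  | insert a s ha ih =>
    simp only [Finset.mem_insert, not_or] at hi
    cases p with
    | zero => simp [es_insert_zero]
    | succ p =>
      rw [es_insert_succ _ a (Finset.mem_insert_self a s), Finset.erase_insert ha, map_add, Derivation.leibniz,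
        ih hi.2, ih hi.2, MvPolynomial.pderiv_X_of_ne (Ne.symm hi.1)]
      simp

/-- pair weight -/
noncomputable def ww (q : ℕ) (i j : Fin l) : MvPolynomial (Fin l) ℝ :=
  MvPolynomial.X i * es (Finset.univ.erase i) q + MvPolynomial.X j * es ((Finset.univ.erase i).erase j) q

lemma ww_spec (q : ℕ) (i j : Fin l) (hij : i ≠ j) :
    ww q i j = ww q j i ∧
    (MvPolynomial.X j - MvPolynomial.X i) * ww q i j = MvPolynomial.X j ^2 * es (Finset.univ.erase j) q
      - MvPolynomial.X i ^2 * es (Finset.univ.erase i) q := by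
  obtain ⟨c, hc⟩ := es_exists ((Finset.univ.erase i).erase j) q
  have h1 := hc (Finset.univ.erase i) j (by simp [hij.symm]) rfl
  have h2 := hc (Finset.univ.erase j) i (by simp [hij]) (Finset.erase_right_comm)
  unfold ww
  rw [Finset.erase_right_comm (a := j) (b := i), h1, h2]
  constructor <;> ring

lemma ww_sum (q : ℕ) : ∑ i : Fin l, ∑ j ∈ Finset.univ.erase i, ww q i j =
    ((q : MvPolynomial (Fin l) ℝ) + 1) * (2 * (l : MvPolynomial (Fin l) ℝ) - 2 - (q : MvPolynomial (Fin l) ℝ)) * es Finset.univ (q+1) := by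
  have : ∀ i : Fin l, ((Finset.univ.erase i).card : MvPolynomial (Fin l) ℝ) = l - 1 := by
    intro i
    have := Finset.card_erase_add_one (Finset.mem_univ i)
    simp only [Finset.card_univ, Fintype.card_fin] at this
    rw [eq_sub_iff_add_eq]; exact_mod_cast this
  have hA : ∑ i : Fin l, ∑ j ∈ Finset.univ.erase i, MvPolynomial.X i * es (Finset.univ.erase i) q
     = ((l : MvPolynomial (Fin l) ℝ) - 1) * (((q : MvPolynomial (Fin l) ℝ) + 1) * es Finset.univ (q+1)) := by
    rw [← es_deriv, Finset.mul_sum]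
    refine Finset.sum_congr rfl fun i _ => ?_
    rw [Finset.sum_const, nsmul_eq_mul, this]
  have hB : ∑ i : Fin l, ∑ j ∈ Finset.univ.erase i, MvPolynomial.X j * es ((Finset.univ.erase i).erase j) q
     = ((l : MvPolynomial (Fin l) ℝ) - 1 - (q : MvPolynomial (Fin l) ℝ)) * (((q : MvPolynomial (Fin l) ℝ) + 1) * es Finset.univ (q+1)) := by
    simp_rw [es_deriv, ← Finset.mul_sum, es_sum]
    simp; ring
  unfold ww
  simp_rw [Finset.sum_add_distrib]
  rw [hA, hB]; ring

lemma sum_pairs {R : Type*} [CommRing R] (w : Fin l → Fin l → R) (hw : ∀ i j, i ≠ j → w i j = w j i) :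
    ∑ i, ∑ j ∈ Finset.univ.erase i, w i j = 2 * ∑ i, ∑ j ∈ Finset.Ioi i, w i j := by
  have h1 : ∀ i : Fin l, ∑ j ∈ Finset.univ.erase i, w i j
      = ∑ j ∈ Finset.Ioi i, w i j + ∑ j ∈ Finset.Iio i, w i j := by
    intro i
    rw [← Finset.sum_union]
    · refine Finset.sum_congr ?_ fun _ _ => rfl
      ext j
      simp only [Finset.mem_erase, Finset.mem_univ, and_true, Finset.mem_union, Finset.mem_Ioi, Finset.mem_Iio]
      constructor
      · intro h; exact (lt_or_gt_of_ne h).symm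
      · rintro (h | h); exacts [h.ne', h.ne]
    · rw [Finset.disjoint_left]; intro j; simp; exact fun h => h.le
  simp_rw [h1]
  rw [Finset.sum_add_distrib, two_mul]
  congr 1
  rw [Finset.sum_comm' (t' := Finset.univ) (s' := fun j => Finset.Ioi j)]
  · refine Finset.sum_congr rfl fun i _ => Finset.sum_congr rfl fun j hj => hw _ _ ?_
    simp at hj; exact hj.ne'
  · simp

noncomputable def vdm (l : ℕ) : MvPolynomial (Fin l) ℝ :=
  ∏ i : Fin l, ∏ j ∈ Finset.Ioi i, (MvPolynomial.X j - MvPolynomial.X i)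

lemma deriv_prod {ι A : Type*} [DecidableEq ι] [CommRing A] [Algebra ℝ A] (D : Derivation ℝ A A) (s : Finset ι) (f w : ι → A)
   (h : ∀ i ∈ s, D (f i) = f i * w i) : D (∏ i ∈ s, f i) = (∏ i ∈ s, f i) * ∑ i ∈ s, w i := by
  induction s using Finset.induction_on with
  | empty => simp
  | insert a s ha ih =>
    rw [Finset.prod_insert ha, Finset.sum_insert ha, Derivation.leibniz, ih (fun i hi => h i (by simp [hi])), h a (by simp)]
    simp only [smul_eq_mul]; ring

lemma vdm_sq (q : ℕ) : ∑ i : Fin l, MvPolynomial.X i ^ 2 * es (Finset.univ.erase i) q * MvPolynomial.pderiv i (vdm l ^ 2)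
   = ((q : MvPolynomial (Fin l) ℝ) + 1) * (2 * (l : MvPolynomial (Fin l) ℝ) - 2 - (q : MvPolynomial (Fin l) ℝ)) * es Finset.univ (q+1) * vdm l ^ 2 := by
  let D : Derivation ℝ (MvPolynomial (Fin l) ℝ) (MvPolynomial (Fin l) ℝ) :=
    ∑ i : Fin l, (MvPolynomial.X i ^ 2 * es (Finset.univ.erase i) q) • MvPolynomial.pderiv i
  have hD : ∀ P, D P = ∑ i : Fin l, MvPolynomial.X i ^ 2 * es (Finset.univ.erase i) q * MvPolynomial.pderiv i P := by
    intro P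
    simp only [D]
    rw [← Derivation.coeFnAddMonoidHom_apply, map_sum, Finset.sum_apply]
    simp
  have hX : ∀ i, D (MvPolynomial.X i) = MvPolynomial.X i ^ 2 * es (Finset.univ.erase i) q := by
    intro i
    rw [hD, Finset.sum_eq_single i]
    · simp
    · intro b _ hb; rw [MvPolynomial.pderiv_X_of_ne hb.symm]; simp
    · simp
  have hV : D (vdm l) = vdm l * ∑ i, ∑ j ∈ Finset.Ioi i, ww q i j := by
    unfold vdm
    refine deriv_prod D _ _ _ fun i _ => deriv_prod D _ _ _ fun j hj => ?_
    rw [map_sub, hX, hX, (ww_spec q i j (by simp at hj; exact hj.ne)).2]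
  rw [← hD, ← ww_sum, sum_pairs _ (fun i j hij => (ww_spec q i j hij).1), pow_two, Derivation.leibniz, hV]
  simp only [smul_eq_mul]; ring

noncomputable def Lf (l : ℕ) (m : ℕ → ℝ) : MvPolynomial (Fin l) ℝ →ₗ[ℝ] ℝ :=
  (MvPolynomial.basisMonomials (Fin l) ℝ).constr ℝ (fun d => ∏ i, m (d i))

lemma Lf_monomial (m : ℕ → ℝ) (d : Fin l →₀ ℕ) (c : ℝ) :
    Lf l m (MvPolynomial.monomial d c) = c * ∏ i, m (d i) := by
  have : MvPolynomial.monomial d c = c • (MvPolynomial.basisMonomials (Fin l) ℝ d) := by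
    simp [MvPolynomial.smul_monomial]
  rw [this, map_smul, Lf, Module.Basis.constr_basis, smul_eq_mul]

lemma prod_add_single (m : ℕ → ℝ) (d : Fin l →₀ ℕ) (i : Fin l) (k : ℕ) :
    ∏ j, m ((d + Finsupp.single i k) j) = m (d i + k) * ∏ j ∈ Finset.univ.erase i, m (d j) := by
  rw [← Finset.mul_prod_erase Finset.univ _ (Finset.mem_univ i)]
  congr 1
  · simp
  · refine Finset.prod_congr rfl fun j hj => ?_
    rw [Finsupp.add_apply, Finsupp.single_eq_of_ne (by simpa using hj), add_zero]

lemma Lf_pearson (m : ℕ → ℝ) (α x : ℝ) (hm : ∀ j : ℕ, m j = (α + 1 + j) * m (j+1) + x * m (j+2))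
    (i : Fin l) (P : MvPolynomial (Fin l) ℝ) :
    Lf l m (P - (α + 1) • (MvPolynomial.X i * P) - x • (MvPolynomial.X i ^ 2 * P)
      - MvPolynomial.X i ^ 2 * MvPolynomial.pderiv i P) = 0 := by
  induction P using MvPolynomial.induction_on' with
  | monomial d c =>
    have h0 : Lf l m (MvPolynomial.monomial d c) = c * (m (d i) * ∏ j ∈ Finset.univ.erase i, m (d j)) := by
      rw [Lf_monomial, Finset.mul_prod_erase Finset.univ (fun j => m (d j)) (Finset.mem_univ i)]
    have h1 : ∀ k c, Lf l m (MvPolynomial.X i ^ k * MvPolynomial.monomial d c) = c * (m (d i + k) * ∏ j ∈ Finset.univ.erase i, m (d j)) := by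
      intro k c
      rw [mul_comm, MvPolynomial.X_pow_eq_monomial, MvPolynomial.monomial_mul, mul_one, Lf_monomial, prod_add_single]
    have h2 : MvPolynomial.X i ^ 2 * MvPolynomial.pderiv i (MvPolynomial.monomial d c) = MvPolynomial.X i ^ 1 * MvPolynomial.monomial d (c * d i) := by
      rw [pow_succ, pow_one, mul_assoc, MvPolynomial.X_mul_pderiv_monomial, nsmul_eq_mul, ← MvPolynomial.C_eq_coe_nat,
        MvPolynomial.C_mul_monomial, mul_comm (c : ℝ)]
    have h3 := h1 1 c
    rw [pow_one] at h3
    rw [h2]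
    simp only [map_sub, map_smul, h0, h1, h3, smul_eq_mul]
    rw [hm (d i)]; ring
  | add P Q hP hQ =>
    rw [← add_zero (0:ℝ)]
    nth_rw 1 [← hP]
    rw [← hQ, ← map_add]
    congr 1
    simp only [map_add, mul_add, smul_add]; ring

lemma Lf_deriv (m : ℕ → ℝ → ℝ) (x : ℝ) (hm : ∀ j, HasDerivAt (m j) (m (j+1) x) x)
    (P : MvPolynomial (Fin l) ℝ) :
    HasDerivAt (fun y => Lf l (fun j => m j y) P) (Lf l (fun j => m j x) (es Finset.univ 1 * P)) x := by
  have he : (es Finset.univ 1 : MvPolynomial (Fin l) ℝ) = ∑ i, MvPolynomial.X i := by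
    have := es_deriv (l := l) Finset.univ 0
    simpa [es_insert_zero] using this.symm
  induction P using MvPolynomial.induction_on' with
  | monomial d c =>
    simp_rw [Lf_monomial]
    refine ((HasDerivAt.fun_finsetProd (u := Finset.univ) (f := fun i y => m (d i) y) (f' := fun i => m (d i + 1) x) (x := x) (fun i _ => hm (d i))).const_mul c).congr_deriv ?_
    symm
    rw [he, Finset.sum_mul, map_sum, Finset.mul_sum]
    refine Finset.sum_congr rfl fun i _ => ?_
    rw [mul_comm, MvPolynomial.X, MvPolynomial.monomial_mul, mul_one, Lf_monomial, prod_add_single (fun j => m j x), smul_eq_mul, mul_comm (m _ x)]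
  | add P Q hP hQ =>
    simp_rw [map_add, mul_add, map_add]
    exact hP.add hQ

lemma key (m : ℕ → ℝ) (α x : ℝ) (hm : ∀ j : ℕ, m j = (α + 1 + j) * m (j+1) + x * m (j+2)) (q : ℕ) :
    x * Lf l m (es Finset.univ 1 * (es Finset.univ (q+1) * vdm l ^ 2)) =
      (l - q) * Lf l m (es Finset.univ q * vdm l ^ 2)
      - (α + 1) * (q + 1) * Lf l m (es Finset.univ (q+1) * vdm l ^ 2)
      + x * (q + 2) * Lf l m (es Finset.univ (q+2) * vdm l ^ 2)
      - (q + 1) * (2 * l - 2 - q) * Lf l m (es Finset.univ (q+1) * vdm l ^ 2) := by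
  have he : (es Finset.univ 1 : MvPolynomial (Fin l) ℝ) = ∑ i, MvPolynomial.X i := by
    have := es_deriv (l := l) Finset.univ 0
    simpa [es_insert_zero] using this.symm
  have h := Finset.sum_eq_zero (s := Finset.univ) fun (i : Fin l) _ => Lf_pearson m α x hm i (es (Finset.univ.erase i) q * vdm l ^ 2)
  rw [← map_sum] at h
  have hq1 := es_deriv (l := l) Finset.univ q
  have hq2 := es_deriv (l := l) Finset.univ (q+1)
  have hs := es_sum (l := l) Finset.univ q
  have hsq : ∑ i : Fin l, MvPolynomial.X i ^ 2 * es (Finset.univ.erase i) q = 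
     es Finset.univ 1 * es Finset.univ (q+1) - ((q : MvPolynomial (Fin l) ℝ) + 2) * es Finset.univ (q+2) := by
    have : ((q:MvPolynomial (Fin l) ℝ) + 2) = ((q+1 : ℕ) : MvPolynomial (Fin l) ℝ) + 1 := by push_cast; ring
    rw [this, ← hq2, he, Finset.sum_mul, ← Finset.sum_sub_distrib]
    refine Finset.sum_congr rfl fun i hi => ?_
    rw [es_insert_succ Finset.univ i hi q]; ring
  have hv := vdm_sq (l := l) q
  have e : ∑ i : Fin l, (es (Finset.univ.erase i) q * vdm l ^ 2 - (α + 1) • (MvPolynomial.X i * (es (Finset.univ.erase i) q * vdm l ^ 2)) - x • (MvPolynomial.X i ^ 2 * (es (Finset.univ.erase i) q * vdm l ^ 2))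
      - MvPolynomial.X i ^ 2 * MvPolynomial.pderiv i (es (Finset.univ.erase i) q * vdm l ^ 2)) =
     ((l:ℝ) - q) • (es Finset.univ q * vdm l ^ 2) - ((α + 1) * (q+1)) • (es Finset.univ (q+1) * vdm l ^ 2)
      - x • (es Finset.univ 1 * (es Finset.univ (q+1) * vdm l ^ 2)) + (x * (q+2)) • (es Finset.univ (q+2) * vdm l ^ 2)
      - (((q:ℝ) + 1) * (2 * l - 2 - q)) • (es Finset.univ (q+1) * vdm l ^ 2) := by
    have e1 : ∀ i : Fin l, MvPolynomial.X i ^ 2 * MvPolynomial.pderiv i (es (Finset.univ.erase i) q * vdm l ^ 2)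
        = MvPolynomial.X i ^ 2 * es (Finset.univ.erase i) q * MvPolynomial.pderiv i (vdm l ^ 2) := by
      intro i
      rw [Derivation.leibniz, es_pderiv _ i (by simp)]
      simp [mul_assoc]
    simp_rw [e1, Finset.sum_sub_distrib, hv, ← Finset.smul_sum, ← mul_assoc, ← Finset.sum_mul, hq1, hs, hsq]
    simp only [MvPolynomial.smul_eq_C_mul, map_mul, map_add, map_sub, map_one, map_natCast, map_ofNat, Finset.card_univ, Fintype.card_fin]
    ring
  rw [e] at h
  simp only [map_sub, map_add, map_smul, smul_eq_mul] at h
  linarith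

lemma Lf_prod (m : ℕ → ℝ) (d : Fin l → ℕ) : Lf l m (∏ i, MvPolynomial.X i ^ d i) = ∏ i, m (d i) := by
  have : (∏ i, MvPolynomial.X i ^ d i : MvPolynomial (Fin l) ℝ) = MvPolynomial.monomial (Finsupp.equivFunOnFinite.symm d) 1 := by
    rw [MvPolynomial.monomial_eq, Finsupp.prod_fintype _ _ (by simp)]; simp
  rw [this, Lf_monomial]; simp

lemma Lf_vdm (m : ℕ → ℝ) : Lf l m (vdm l ^ 2) = (l.factorial : ℝ) * Matrix.det (fun j k : Fin l => m (j + k)) := by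
  have hV : vdm l = ∑ σ : Equiv.Perm (Fin l), ((Equiv.Perm.sign σ : ℤ) : MvPolynomial (Fin l) ℝ) * ∏ i, MvPolynomial.X i ^ ((σ i : Fin l) : ℕ) := by
    rw [vdm, ← Matrix.det_vandermonde, ← Matrix.det_transpose, Matrix.det_apply']
    rfl
  rw [pow_two, hV, Finset.sum_mul_sum, map_sum]
  have : ∀ σ : Equiv.Perm (Fin l), Lf l m (∑ ρ : Equiv.Perm (Fin l), ((Equiv.Perm.sign σ : ℤ) : MvPolynomial (Fin l) ℝ) * (∏ i, MvPolynomial.X i ^ ((σ i : Fin l) : ℕ)) *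
     (((Equiv.Perm.sign ρ : ℤ) : MvPolynomial (Fin l) ℝ) * ∏ i, MvPolynomial.X i ^ ((ρ i : Fin l) : ℕ))) = Matrix.det (fun j k : Fin l => m (j + k)) := by
    intro σ
    have h1 : ∀ ρ : Equiv.Perm (Fin l), Lf l m (((Equiv.Perm.sign σ : ℤ) : MvPolynomial (Fin l) ℝ) * (∏ i, MvPolynomial.X i ^ ((σ i : Fin l) : ℕ)) *
     (((Equiv.Perm.sign ρ : ℤ) : MvPolynomial (Fin l) ℝ) * ∏ i, MvPolynomial.X i ^ ((ρ i : Fin l) : ℕ))) = ((Equiv.Perm.sign σ : ℤ) : ℝ) * (((Equiv.Perm.sign ρ : ℤ) : ℝ) * ∏ i, m ((σ i : ℕ) + (ρ i : ℕ))) := by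
      intro ρ
      rw [← Lf_prod]
      simp_rw [pow_add, Finset.prod_mul_distrib, ← smul_eq_mul (a := ((_ : ℤ) : ℝ)), ← map_smul, MvPolynomial.smul_eq_C_mul, map_intCast]
      congr 1; ring
    rw [map_sum]
    simp_rw [h1]
    rw [← Finset.mul_sum]
    have := Matrix.det_permute σ (fun j k : Fin l => m (j + k))
    rw [← Matrix.det_transpose, Matrix.det_apply'] at this
    have this' : ∑ ρ : Equiv.Perm (Fin l), ((Equiv.Perm.sign ρ : ℤ) : ℝ) * ∏ i, m ((σ i : ℕ) + (ρ i : ℕ)) = ((Equiv.Perm.sign σ : ℤ) : ℝ) * Matrix.det (fun j k : Fin l => m (j + k)) := this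
    rw [this', ← mul_assoc, ← Int.cast_mul]
    rcases Int.units_eq_one_or (Equiv.Perm.sign σ) with h | h <;> simp [h]
  rw [Finset.sum_congr rfl fun σ _ => this σ]
  simp [Fintype.card_perm]

lemma es_big (s : Finset (Fin l)) (p : ℕ) (hp : s.card < p) : es s p = 0 := by
  induction s using Finset.induction_on generalizing p with
  | empty =>
    cases p with
    | zero => simp at hp
    | succ p => simp [es, Polynomial.coeff_one]
  | insert a s ha ih =>
    rw [Finset.card_insert_of_notMem ha] at hp
    cases p with
    | zero => simp at hp
    | succ p =>
      rw [es_insert_succ _ a (Finset.mem_insert_self a s), Finset.erase_insert ha, ih _ (by omega), ih _ (by omega)]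
      simp


lemma ode_step (T : ℕ → ℝ → ℝ) (hT : ∀ n x, 0 < x → HasDerivAt (T n) (T (n+1) x) x)
    (p : ℕ) (P Q : ℕ → Polynomial ℝ)
    (wP : ∀ n k, p < 2 * k + n → (P n).coeff k = 0)
    (wQ : ∀ n k, p < 2 * k + n + 1 → (Q n).coeff k = 0)
    (hP1 : P p = 1) (F F' G : ℝ → ℝ)
    (hF : ∀ N, p < N → ∀ x, 0 < x → ∑ n ∈ Finset.range N, x ^ n * (P n).eval x * T n x = F x)
    (hG : ∀ N, p < N → ∀ x, 0 < x → ∑ n ∈ Finset.range N, x ^ n * (Q n).eval x * T n x = G x)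
    (hFd : ∀ x, 0 < x → HasDerivAt F (F' x) x) (a e : ℝ) :
    ∃ R : ℕ → Polynomial ℝ, (∀ n k, p + 1 < 2 * k + n → (R n).coeff k = 0) ∧ R (p+1) = 1 ∧
      ∀ N, p + 1 < N → ∀ x, 0 < x →
        ∑ n ∈ Finset.range N, x ^ n * (R n).eval x * T n x = x * F' x - a * F x - e * x * G x := by
  have P0 : ∀ n, p < n → P n = 0 := fun n hn => by
    ext k; rw [wP n k (by omega)]; simp
  have Q0 : ∀ n, p < n + 1 → Q n = 0 := fun n hn => by
    ext k; rw [wQ n k (by omega)]; simp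
  let S : ℕ → Polynomial ℝ := fun n => Nat.casesOn n 0 P
  refine ⟨fun n => Polynomial.C ((n : ℝ) - a) * P n + Polynomial.X * derivative (P n) + S n
    - Polynomial.C e * (Polynomial.X * Q n), ?_, ?_, ?_⟩
  · intro n k hk
    have hS : (S n).coeff k = 0 := by
      cases n with
      | zero => simp [S]
      | succ n => exact wP n k (by omega)
    rw [Polynomial.coeff_sub, Polynomial.coeff_add, Polynomial.coeff_add, hS, Polynomial.coeff_C_mul,
      Polynomial.coeff_C_mul, wP n k (by omega)]
    cases k with
    | zero => simp
    | succ k =>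
      rw [Polynomial.coeff_X_mul, Polynomial.coeff_X_mul, Polynomial.coeff_derivative, wP n (k+1) (by omega),
        wQ n k (by omega)]
      simp
  · simp [S, P0 (p+1) (by omega), Q0 (p+1) (by omega), hP1]
  · intro M hM x hx
    obtain ⟨N, rfl⟩ : ∃ N, M = N + 1 := ⟨M - 1, by omega⟩
    have hN : p < N := by omega
    have hd : HasDerivAt (fun y => ∑ n ∈ Finset.range N, y ^ n * (P n).eval y * T n y)
        (∑ n ∈ Finset.range N, (((n : ℝ) * x ^ (n - 1) * (P n).eval x + x ^ n * (derivative (P n)).eval x) * T n x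
          + x ^ n * (P n).eval x * T (n+1) x)) x := by
      refine HasDerivAt.fun_sum fun n _ => ?_
      exact ((hasDerivAt_pow n x).mul ((P n).hasDerivAt x)).mul (hT n x hx)
    have hd2 : HasDerivAt (fun y => ∑ n ∈ Finset.range N, y ^ n * (P n).eval y * T n y) (F' x) x := by
      refine (hFd x hx).congr_of_eventuallyEq ?_
      filter_upwards [lt_mem_nhds hx] with y hy
      exact hF N hN y hy
    have heq := hd.unique hd2
    have hS : ∑ n ∈ Finset.range (N+1), x ^ n * (S n).eval x * T n x
        = ∑ n ∈ Finset.range N, x ^ (n+1) * (P n).eval x * T (n+1) x := by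
      rw [Finset.sum_range_succ']
      simp [S]
    have h1 : ∑ n ∈ Finset.range (N+1), x ^ n * (((n : ℝ)) * (P n).eval x + x * (derivative (P n)).eval x) * T n x
        + ∑ n ∈ Finset.range (N+1), x ^ n * (S n).eval x * T n x = x * F' x := by
      rw [← heq, hS, Finset.sum_range_succ, P0 N hN, Finset.mul_sum]
      simp only [Polynomial.eval_zero, Polynomial.derivative_zero, mul_zero, add_zero, zero_mul]
      rw [← Finset.sum_add_distrib]
      refine Finset.sum_congr rfl fun n _ => ?_
      cases n with
      | zero => simp; ring
      | succ n => simp only [Nat.add_sub_cancel]; ring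
    rw [← h1, ← hF (N+1) (by omega) x hx, ← hG (N+1) (by omega) x hx, Finset.mul_sum, Finset.mul_sum,
      ← Finset.sum_add_distrib, ← Finset.sum_sub_distrib, ← Finset.sum_sub_distrib]
    refine Finset.sum_congr rfl fun n _ => ?_
    simp only [Polynomial.eval_sub, Polynomial.eval_add, Polynomial.eval_mul, Polynomial.eval_C, Polynomial.eval_X]
    ring

lemma ode_exists (T : ℕ → ℝ → ℝ) (hT : ∀ n x, 0 < x → HasDerivAt (T n) (T (n+1) x) x)
    (K D : ℕ → ℝ → ℝ) (a b d : ℕ → ℝ) (hT0 : ∀ x, 0 < x → T 0 x = K 0 x)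
    (hK : ∀ p x, 0 < x → HasDerivAt (K p) (D p x) x)
    (h0 : ∀ x, 0 < x → x * D 0 x = a 0 * K 0 x + b 0 * K 1 x)
    (h1 : ∀ p x, 0 < x → x * D (p+1) x = a (p+1) * K (p+1) x + b (p+1) * K (p+2) x + d p * x * K p x)
    (p : ℕ) :
    ∃ P : ℕ → Polynomial ℝ, (∀ n k, p < 2 * k + n → (P n).coeff k = 0) ∧ P p = 1 ∧
      ∀ N, p < N → ∀ x, 0 < x →
        ∑ n ∈ Finset.range N, x ^ n * (P n).eval x * T n x = (∏ i ∈ Finset.range p, b i) * K p x := by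
  suffices H : ∀ p, (∃ P : ℕ → Polynomial ℝ, (∀ n k, p < 2 * k + n → (P n).coeff k = 0) ∧ P p = 1 ∧
      ∀ N, p < N → ∀ x, 0 < x →
        ∑ n ∈ Finset.range N, x ^ n * (P n).eval x * T n x = (∏ i ∈ Finset.range p, b i) * K p x) ∧ 
      (∃ P : ℕ → Polynomial ℝ, (∀ n k, p + 1 < 2 * k + n → (P n).coeff k = 0) ∧ P (p + 1) = 1 ∧
      ∀ N, p + 1 < N → ∀ x, 0 < x →
        ∑ n ∈ Finset.range N, x ^ n * (P n).eval x * T n x = (∏ i ∈ Finset.range (p + 1), b i) * K (p + 1) x) from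
    (H p).1
  intro p
  induction p with
  | zero =>
    have A : ∃ P : ℕ → Polynomial ℝ, (∀ n k, 0 < 2 * k + n → (P n).coeff k = 0) ∧ P 0 = 1 ∧
      ∀ N, 0 < N → ∀ x, 0 < x →
        ∑ n ∈ Finset.range N, x ^ n * (P n).eval x * T n x = (∏ i ∈ Finset.range 0, b i) * K 0 x := by
      refine ⟨fun n => if n = 0 then 1 else 0, ?_, by simp, ?_⟩
      · intro n k h
        rcases Nat.eq_zero_or_pos n with rfl | hn
        · simp [Polynomial.coeff_one]; omega
        · simp [hn.ne']
      · intro N hN x hx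
        rw [Finset.sum_eq_single 0]
        · simp [hT0 x hx]
        · intro n _ hn; simp [hn]
        · simp; omega
    refine ⟨A, ?_⟩
    obtain ⟨P, wP, P1, hP⟩ := A
    obtain ⟨R, wR, R1, hR⟩ := ode_step T hT 0 P (fun _ => 0) wP (by simp) P1 _ (fun x => D 0 x) (fun _ => 0)
      (fun N hN x hx => (hP N hN x hx).trans (by simp : _ = K 0 x)) (by simp) (fun x hx => hK 0 x hx) (a 0) 0
    refine ⟨R, wR, R1, fun N hN x hx => ?_⟩
    rw [hR N hN x hx, h0 x hx]; simp
  | succ p ih =>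
    refine ⟨ih.2, ?_⟩
    obtain ⟨⟨Q, wQ, -, hQ⟩, ⟨P, wP, P1, hP⟩⟩ := ih
    obtain ⟨R, wR, R1, hR⟩ := ode_step T hT (p+1) P Q wP (fun n k h => wQ n k (by omega)) P1 _
      (fun x => (∏ i ∈ Finset.range (p + 1), b i) * D (p+1) x) _ hP (fun N hN x hx => hQ N (by omega) x hx)
      (fun x hx => (hK (p+1) x hx).const_mul _) (a (p+1)) (b p * d p)
    refine ⟨R, wR, R1, fun N hN x hx => ?_⟩
    have := h1 p x hx
    rw [hR N hN x hx, Finset.prod_range_succ _ (p+1), Finset.prod_range_succ _ p]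
    linear_combination (∏ i ∈ Finset.range p, b i) * b p * this

lemma smooth_of (K D : ℕ → ℝ → ℝ) (a b d : ℕ → ℝ)
    (hK : ∀ p x, 0 < x → HasDerivAt (K p) (D p x) x)
    (h0 : ∀ x, 0 < x → x * D 0 x = a 0 * K 0 x + b 0 * K 1 x)
    (h1 : ∀ p x, 0 < x → x * D (p+1) x = a (p+1) * K (p+1) x + b (p+1) * K (p+2) x + d p * x * K p x)
    (n : ℕ) : ∀ p, ContDiffOn ℝ n (K p) (Set.Ioi 0) := by
  induction n with
  | zero =>
    intro p
    exact contDiffOn_zero.2 fun x hx => (hK p x hx).continuousAt.continuousWithinAt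
  | succ n ih =>
    intro p
    push_cast
    rw [contDiffOn_succ_iff_deriv_of_isOpen isOpen_Ioi]
    refine ⟨fun x hx => (hK p x hx).differentiableAt.differentiableWithinAt, by simp, ?_⟩
    have hinv : ContDiffOn ℝ n (fun x : ℝ => x⁻¹) (Set.Ioi 0) := fun x hx =>
      (contDiffAt_inv ℝ (ne_of_gt hx)).contDiffWithinAt
    have hD : ∀ x ∈ Set.Ioi (0:ℝ), deriv (K p) x = x⁻¹ * (x * D p x) := fun x hx => by
      rw [(hK p x hx).deriv, inv_mul_cancel_left₀ (ne_of_gt hx)]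
    cases p with
    | zero =>
      have : ContDiffOn ℝ n (fun x => x⁻¹ * (a 0 * K 0 x + b 0 * K 1 x)) (Set.Ioi 0) :=
        hinv.mul ((contDiffOn_const.mul (ih 0)).add (contDiffOn_const.mul (ih 1)))
      exact this.congr fun x hx => by rw [hD x hx, h0 x hx]
    | succ p =>
      have : ContDiffOn ℝ n (fun x => x⁻¹ * (a (p+1) * K (p+1) x + b (p+1) * K (p+2) x + d p * x * K p x)) (Set.Ioi 0) :=
        hinv.mul (((contDiffOn_const.mul (ih _)).add (contDiffOn_const.mul (ih _))).add
          ((contDiffOn_const.mul contDiffOn_id).mul (ih _)))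
      exact this.congr fun x hx => by rw [hD x hx, h1 p x hx]

lemma iter_hasDeriv (f : ℝ → ℝ) (hf : ∀ n : ℕ, ContDiffOn ℝ n f (Set.Ioi 0)) (n : ℕ) (x : ℝ) (hx : 0 < x) :
    HasDerivAt (iteratedDeriv n f) (iteratedDeriv (n+1) f x) x := by
  rw [iteratedDeriv_succ]
  apply DifferentiableAt.hasDerivAt
  have h := (hf (n+1)).differentiableOn_iteratedDerivWithin (m := n) (by exact_mod_cast Nat.lt_succ_self n) isOpen_Ioi.uniqueDiffOn
  have h2 : DifferentiableOn ℝ (iteratedDeriv n f) (Set.Ioi 0) :=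
    h.congr fun y hy => (iteratedDerivWithin_of_isOpen isOpen_Ioi hy).symm
  exact h2.differentiableAt (isOpen_Ioi.mem_nhds hx)

/-! Bessel part -/

noncomputable def gg (ν x : ℝ) : ℝ :=
  ∑' k : ℕ, x ^ k / ((k.factorial : ℝ) * Real.Gamma (ν + (k : ℝ) + 1))

lemma Gamma_lower (ν : ℝ) (hν : 0 ≤ ν) (k : ℕ) : Real.Gamma (ν + 1) ≤ Real.Gamma (ν + k + 1) := by
  induction k with
  | zero => simp
  | succ k ih =>
    have : ν + ((k+1 : ℕ) : ℝ) + 1 = (ν + k + 1) + 1 := by push_cast; ring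
    have hpos : 0 < ν + k + 1 := by positivity
    rw [this, Real.Gamma_add_one hpos.ne']
    have := Real.Gamma_pos_of_pos hpos
    have : (0:ℝ) ≤ k := by positivity
    nlinarith

lemma gg_bound (ν : ℝ) (hν : 0 ≤ ν) (x R : ℝ) (hx : |x| ≤ R) (k : ℕ) :
    ‖x ^ k / ((k.factorial : ℝ) * Real.Gamma (ν + (k : ℝ) + 1))‖ ≤ R ^ k / k.factorial * (Real.Gamma (ν + 1))⁻¹ := by
  have h1 : 0 < Real.Gamma (ν + 1) := Real.Gamma_pos_of_pos (by positivity)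
  have h2 := Gamma_lower ν hν k
  have h3 : (0:ℝ) < k.factorial := by positivity
  rw [norm_div, norm_pow, Real.norm_eq_abs, Real.norm_eq_abs, abs_of_pos (mul_pos h3 (h1.trans_le h2)), ← div_eq_mul_inv, div_div]
  have hR : 0 ≤ R := (abs_nonneg x).trans hx
  have hRk : 0 ≤ R ^ k := pow_nonneg hR k
  gcongr

lemma gg_summable (ν : ℝ) (hν : 0 ≤ ν) (x : ℝ) :
    Summable fun k : ℕ => x ^ k / ((k.factorial : ℝ) * Real.Gamma (ν + (k : ℝ) + 1)) :=
  Summable.of_norm_bounded ((Real.summable_pow_div_factorial |x|).mul_right _) (gg_bound ν hν x |x| le_rfl)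

lemma gg_deriv (ν : ℝ) (hν : 0 ≤ ν) (x : ℝ) : HasDerivAt (gg ν) (gg (ν + 1) x) x := by
  have hs := fun y => gg_summable ν hν y
  have hsplit : gg ν = fun y => (Real.Gamma (ν + 1))⁻¹ + ∑' k : ℕ, y ^ (k+1) / (((k+1).factorial : ℝ) * Real.Gamma (ν + ((k+1 : ℕ) : ℝ) + 1)) := by
    funext y
    rw [gg, (hs y).tsum_eq_zero_add]
    simp
  rw [hsplit]
  refine HasDerivAt.const_add _ ?_
  have hterm : ∀ (k : ℕ) (y : ℝ), HasDerivAt (fun y : ℝ => y ^ (k+1) / (((k+1).factorial : ℝ) * Real.Gamma (ν + ((k+1 : ℕ) : ℝ) + 1)))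
      (y ^ k / ((k.factorial : ℝ) * Real.Gamma (ν + 1 + (k : ℝ) + 1))) y := by
    intro k y
    refine ((hasDerivAt_pow (k+1) y).div_const _).congr_deriv ?_
    have e : ν + ((k+1 : ℕ) : ℝ) + 1 = ν + 1 + k + 1 := by push_cast; ring
    have h1 : 0 < Real.Gamma (ν + 1 + k + 1) := Real.Gamma_pos_of_pos (by positivity)
    rw [e, Nat.factorial_succ]
    push_cast
    have : (0:ℝ) < k.factorial := by positivity
    field_simp
  refine hasDerivAt_tsum_of_isPreconnected (t := Metric.ball (0:ℝ) (|x| + 1)) (y₀ := x) (y := x)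
    (u := fun k : ℕ => (|x|+1) ^ k / k.factorial * (Real.Gamma (ν + 1 + 1))⁻¹)
    ((Real.summable_pow_div_factorial (|x|+1)).mul_right _)
    Metric.isOpen_ball (convex_ball _ _).isPreconnected (fun k y _ => hterm k y) ?_ (by simp) 
    ((summable_nat_add_iff 1).2 (hs x)) (by simp)
  intro k y hy
  refine gg_bound (ν + 1) (by positivity) y _ ?_ k
  simp at hy
  exact hy.le

lemma gg_rec (ν : ℝ) (hν : 0 ≤ ν) (x : ℝ) : gg ν x = (ν + 1) * gg (ν + 1) x + x * gg (ν + 2) x := by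
  have s0 := gg_summable ν hν x
  have s1 := gg_summable (ν+1) (by positivity) x
  have s2 := gg_summable (ν+2) (by positivity) x
  have hG : ∀ y : ℝ, 0 < y → Real.Gamma (y + 1) = y * Real.Gamma y := fun y hy => Real.Gamma_add_one hy.ne'
  unfold gg
  rw [s0.tsum_eq_zero_add, s1.tsum_eq_zero_add, mul_add]
  refine (congrArg₂ (· + ·) ?_ ?_).trans (add_assoc _ _ _).symm
  · have := hG (ν + 1) (by positivity)
    have h1 : 0 < Real.Gamma (ν + 1) := Real.Gamma_pos_of_pos (by positivity)
    simp [this]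
    field_simp
  · rw [← tsum_mul_left, ← tsum_mul_left, ← Summable.tsum_add (((summable_nat_add_iff 1).2 s1).mul_left _) (s2.mul_left _)]
    refine tsum_congr fun k => ?_
    have h1 : 0 < Real.Gamma (ν + k + 2) := Real.Gamma_pos_of_pos (by positivity)
    have h2 : Real.Gamma (ν + k + 3) = (ν + k + 2) * Real.Gamma (ν + k + 2) := by
      rw [← hG _ (by positivity)]; congr 1; ring
    have e1 : ν + ((k+1 : ℕ) : ℝ) + 1 = ν + k + 2 := by push_cast; ring
    have e2 : ν + 1 + ((k+1 : ℕ) : ℝ) + 1 = ν + k + 3 := by push_cast; ring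
    have e3 : ν + 2 + (k : ℝ) + 1 = ν + k + 3 := by ring
    have h3 : (0:ℝ) < k.factorial := by positivity
    have h4 : 0 < ν + k + 2 := by positivity
    rw [e1, e2, e3, h2, Nat.factorial_succ]
    push_cast
    field_simp
    ring

lemma bessel_eq (ν x : ℝ) (hx : 0 < x) : besselI ν (2 * Real.sqrt x) = x ^ (ν / 2) * gg ν x := by
  unfold besselI gg
  rw [← tsum_mul_left]
  refine tsum_congr fun k => ?_
  have : (2 * Real.sqrt x / 2) ^ (ν + 2 * (k : ℝ)) = x ^ (ν / 2) * x ^ k := by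
    rw [mul_div_cancel_left₀ _ (by norm_num : (2:ℝ) ≠ 0), Real.sqrt_eq_rpow, ← Real.rpow_mul hx.le, ← Real.rpow_natCast x k,
      ← Real.rpow_add hx]
    congr 1; ring
  rw [this, mul_div_assoc]

/-- exponent -/
noncomputable def cc (α : ℝ) (l : ℕ) : ℝ := ∑ j : Fin l, ((j : ℕ) : ℝ) / 2 + ∑ k : Fin l, (((k : ℕ) : ℝ) + α) / 2

lemma tau_eq (α : ℝ) (l : ℕ) (x : ℝ) (hx : 0 < x) :
    tauHankelShift α l x = x ^ cc α l * Matrix.det (fun j k : Fin l => gg (α + ((j + k : ℕ) : ℝ)) x) := by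
  have h1 := Matrix.det_mul_row (fun k : Fin l => x ^ ((((k : ℕ) : ℝ) + α) / 2)) (Matrix.of fun j k : Fin l => gg (α + ((j + k : ℕ) : ℝ)) x)
  have h2 := Matrix.det_mul_column (fun k : Fin l => x ^ (((k : ℕ) : ℝ) / 2)) (Matrix.of fun j k : Fin l => x ^ ((((k : ℕ) : ℝ) + α) / 2) * gg (α + ((j + k : ℕ) : ℝ)) x)
  unfold tauHankelShift cc
  rw [Real.rpow_add hx, Real.rpow_sum_of_pos hx, Real.rpow_sum_of_pos hx, mul_assoc]
  refine Eq.trans ?_ (h2.trans (congrArg _ h1))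
  congr 1
  funext j k
  simp only [Matrix.of_apply]
  rw [bessel_eq _ _ hx, ← mul_assoc, ← Real.rpow_add hx]
  congr 2
  · ring
  · push_cast; ring

noncomputable def KK (α : ℝ) (l p : ℕ) (x : ℝ) : ℝ :=
  (l.factorial : ℝ)⁻¹ * (x ^ (cc α l + p) * Lf l (fun j => gg (α + j) x) (es Finset.univ p * vdm l ^ 2))

noncomputable def DD (α : ℝ) (l p : ℕ) (x : ℝ) : ℝ :=
  (l.factorial : ℝ)⁻¹ * ((cc α l + p) * x ^ (cc α l + p - 1) * Lf l (fun j => gg (α + j) x) (es Finset.univ p * vdm l ^ 2)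
    + x ^ (cc α l + p) * Lf l (fun j => gg (α + j) x) (es Finset.univ 1 * (es Finset.univ p * vdm l ^ 2)))

lemma KK_deriv (α : ℝ) (hα : 0 ≤ α) (l p : ℕ) (x : ℝ) (hx : 0 < x) : HasDerivAt (KK α l p) (DD α l p x) x := by
  refine HasDerivAt.const_mul _ ?_
  refine HasDerivAt.mul (Real.hasDerivAt_rpow_const (Or.inl hx.ne')) ?_
  refine Lf_deriv (fun j y => gg (α + j) y) x (fun j => ?_) _
  have := gg_deriv (α + j) (by positivity) x
  rw [add_assoc] at this
  exact_mod_cast this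

lemma KK_zero (α : ℝ) (l : ℕ) (x : ℝ) (hx : 0 < x) : KK α l 0 x = tauHankelShift α l x := by
  rw [tau_eq α l x hx, KK, es_insert_zero, one_mul, Lf_vdm]
  have : (l.factorial : ℝ) ≠ 0 := by positivity
  simp only [Nat.cast_zero, add_zero]
  field_simp

end HankelAux

open HankelAux in
theorem hankel_det_satisfies_linear_ODE (α : ℝ) (hα : 0 ≤ α) (l : ℕ) (hl : 1 ≤ l) :
    ∃ p : ℕ → Polynomial ℝ,
      (∃ n : ℕ, n ≤ l + 1 ∧ p n ≠ 0)
      ∧ (∀ n : ℕ, n ≤ l + 1 → (p n).natDegree ≤ (l + 1 - n) / 2)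
      ∧ (∀ x : ℝ, 0 < x →
          ∑ n ∈ Finset.range (l + 2),
            x ^ n * (p n).eval x * iteratedDeriv n (tauHankelShift α l) x = 0) := by
  let a : ℕ → ℝ := fun p => cc α l + p - (α + 1) * p - p * (2 * l - 1 - p)
  let b : ℕ → ℝ := fun p => p + 1
  let d : ℕ → ℝ := fun p => l - p
  have hr : ∀ (p : ℕ) (x : ℝ), 0 < x → x * x ^ (cc α l + p - 1) = x ^ (cc α l + p) ∧
      x ^ (cc α l + (p + 1 : ℕ)) = x * x ^ (cc α l + p) := by
    intro p x hx
    rw [Real.rpow_sub_one hx.ne']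
    push_cast
    rw [← add_assoc, Real.rpow_add_one hx.ne']
    constructor
    · field_simp
    · ring
  have h0 : ∀ x, 0 < x → x * DD α l 0 x = a 0 * KK α l 0 x + b 0 * KK α l 1 x := by
    intro x hx
    have h := hr 0 x hx
    simp only [KK, DD, a, b, es_insert_zero, one_mul]
    have h2 : x ^ (cc α l + (1:ℕ)) = x * x ^ (cc α l + (0:ℕ)) := h.2
    rw [h2, ← h.1]
    push_cast
    ring
  have h1 : ∀ p x, 0 < x → x * DD α l (p+1) x = a (p+1) * KK α l (p+1) x + b (p+1) * KK α l (p+2) x + d p * x * KK α l p x := by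
    intro p x hx
    have e1 := (hr (p+1) x hx).1
    have e2 := (hr (p+1) x hx).2
    have e3 := (hr p x hx).2
    have hk := key (l := l) (fun j => gg (α + j) x) α x (fun j => by
      have := gg_rec (α + j) (by positivity) x
      push_cast
      rw [this]; ring_nf) p
    have e4 : x * DD α l (p+1) x = (l.factorial : ℝ)⁻¹ * ((cc α l + (p+1 : ℕ)) * (x * x ^ (cc α l + (p+1:ℕ) - 1)) * Lf l (fun j => gg (α + j) x) (es Finset.univ (p+1) * vdm l ^ 2)
       + x ^ (cc α l + (p+1:ℕ)) * (x * Lf l (fun j => gg (α + j) x) (es Finset.univ 1 * (es Finset.univ (p+1) * vdm l ^ 2)))) := by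
      unfold DD; ring
    rw [e4, e1, hk]
    simp only [KK, a, b, d]
    rw [show p + 2 = p + 1 + 1 from rfl, e2, e3]
    push_cast
    ring
  have hK := fun p x hx => KK_deriv α hα l p x hx
  have hsm := fun n => smooth_of (KK α l) (DD α l) a b d hK h0 h1 n 0
  obtain ⟨P, wP, P1, hP⟩ := ode_exists (fun n => iteratedDeriv n (KK α l 0)) (iter_hasDeriv _ hsm)
    (KK α l) (DD α l) a b d (by simp) hK h0 h1 (l+1)
  refine ⟨P, ⟨l+1, le_rfl, by rw [P1]; exact one_ne_zero⟩, fun n hn => ?_, fun x hx => ?_⟩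
  · rw [Polynomial.natDegree_le_iff_coeff_eq_zero]
    intro k hk
    exact wP n k (by omega)
  · have h := hP (l+2) (by omega) x hx
    have hz : KK α l (l+1) x = 0 := by
      rw [KK, es_big _ _ (by simp)]; simp
    rw [hz, mul_zero] at h
    rw [← h]
    refine Finset.sum_congr rfl fun n _ => ?_
    congr 1
    refine Filter.EventuallyEq.iteratedDeriv_eq n ?_
    filter_upwards [lt_mem_nhds hx] with y hy
    exact (KK_zero α l y hy).symm
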